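/- There exists a constant C > 0 such that for all Schwartz functions f, g : ℝ³ → ℝ and every multi-index α with 1 ≤ |α| ≤ 4 one has ‖∂^α(fg)‖_{L²(ℝ³)} ≤ C ‖∇f‖_{H³(ℝ³)} ‖∇g‖_{H³(ℝ³)}, where for an integer m ≥ 0, ‖h‖_{H^m}² = Σ_{|β|≤m} ‖∂^β h‖²_{L²(ℝ³)} and ‖∇f‖_{H³}² = Σ_{|β|=1} ‖∂^β f‖²_{H³}. -/

import Mathlib

noncomputable section

open MeasureTheory
open scoped ENNReal

/-- The spatial domain `ℝ³`. -/
abbrev Sp : Type := EuclideanSpace ℝ (Fin 3)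

/-- Partial derivative in the `i`-th coordinate direction. -/
def pd (i : Fin 3) (f : Sp → ℝ) : Sp → ℝ :=
  fun x => fderiv ℝ f x (EuclideanSpace.single i 1)

/-- Iterated partial derivative `∂₀^a ∂₁^b ∂₂^c`, i.e. `∂^α` for `α = (a,b,c)`. -/
def mpd (a b c : ℕ) (f : Sp → ℝ) : Sp → ℝ :=
  (pd 0)^[a] ((pd 1)^[b] ((pd 2)^[c] f))

/-- Squared `L²(ℝ³)` norm, valued in `ℝ≥0∞`. -/
def nsq (f : Sp → ℝ) : ℝ≥0∞ := (eLpNorm f 2 volume) ^ 2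

/-- Squared Sobolev `H^m(ℝ³)` norm: `Σ_{|α| ≤ m} ‖∂^α f‖_{L²}²`. -/
def sobSq (m : ℕ) (f : Sp → ℝ) : ℝ≥0∞ :=
  ∑ a ∈ Finset.range (m+1), ∑ b ∈ Finset.range (m+1), ∑ c ∈ Finset.range (m+1),
    if a + b + c ≤ m then nsq (mpd a b c f) else 0

/-- Squared `L²` norm of the collection `∇^m f`: `Σ_{|α| = m} ‖∂^α f‖_{L²}²`. -/
def dmSq (m : ℕ) (f : Sp → ℝ) : ℝ≥0∞ :=
  ∑ a ∈ Finset.range (m+1), ∑ b ∈ Finset.range (m+1), ∑ c ∈ Finset.range (m+1),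
    if a + b + c = m then nsq (mpd a b c f) else 0

/-- Squared `H^m` norm of the gradient `∇f`. -/
def gradSobSq (m : ℕ) (f : Sp → ℝ) : ℝ≥0∞ := ∑ i : Fin 3, sobSq m (pd i f)

open SchwartzMap LineDeriv FourierTransform

/-- The Schwartz-space version of `pd`. -/
def schwartzPd (i : Fin 3) (f : 𝓢(Sp, ℝ)) : 𝓢(Sp, ℝ) :=
  ∂_{EuclideanSpace.single i (1 : ℝ)} f

theorem coe_schwartzPd (i : Fin 3) (f : 𝓢(Sp, ℝ)) : ⇑(schwartzPd i f) = pd i ⇑f := rfl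

theorem schwartzPd_add (i : Fin 3) (f g : 𝓢(Sp, ℝ)) :
    schwartzPd i (f + g) = schwartzPd i f + schwartzPd i g :=
  lineDerivOp_add _ _ _

theorem schwartzPd_comm (i j : Fin 3) : Function.Commute (schwartzPd i) (schwartzPd j) := by
  intro f
  ext x
  have hf : ContDiffAt ℝ 2 f x := (f.smooth 2).contDiffAt
  have hd : DifferentiableAt ℝ (fderiv ℝ f) x :=
    ((f.smooth 2).fderiv_right (m := 1) (by norm_num)).differentiable one_ne_zero x
  have hsymm := hf.isSymmSndFDerivAt (by simp) (EuclideanSpace.single i 1)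
    (EuclideanSpace.single j 1)
  simp only [coe_schwartzPd]
  unfold pd
  rw [fderiv_clm_apply hd (by fun_prop), fderiv_clm_apply hd (by fun_prop)]
  simpa using hsymm

/-- The Schwartz-space version of `mpd`. -/
def schwartzMpd (a b c : ℕ) (f : 𝓢(Sp, ℝ)) : 𝓢(Sp, ℝ) :=
  (schwartzPd 0)^[a] ((schwartzPd 1)^[b] ((schwartzPd 2)^[c] f))

theorem coe_schwartzMpd (a b c : ℕ) (f : 𝓢(Sp, ℝ)) :
    ⇑(schwartzMpd a b c f) = mpd a b c ⇑f := by
  have h (i : Fin 3) (n : ℕ) (f : 𝓢(Sp, ℝ)) : ⇑((schwartzPd i)^[n] f) = (pd i)^[n] ⇑f :=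
    Function.Semiconj.iterate_right (f := fun f : 𝓢(Sp, ℝ) => ⇑f) (coe_schwartzPd i) n f
  simp only [schwartzMpd, mpd, h]

/-- The iterated partial derivative of a Schwartz function along a list of coordinates, the head
of the list being applied first. -/
def listDeriv : List (Fin 3) → 𝓢(Sp, ℝ) → 𝓢(Sp, ℝ)
  | [], f => f
  | i :: l, f => listDeriv l (schwartzPd i f)

theorem listDeriv_append (l₁ l₂ : List (Fin 3)) (f : 𝓢(Sp, ℝ)) :
    listDeriv (l₁ ++ l₂) f = listDeriv l₂ (listDeriv l₁ f) := by
  induction l₁ generalizing f with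
  | nil => rfl
  | cons i l ih => exact ih _

theorem listDeriv_add (l : List (Fin 3)) (f g : 𝓢(Sp, ℝ)) :
    listDeriv l (f + g) = listDeriv l f + listDeriv l g := by
  induction l generalizing f g with
  | nil => rfl
  | cons i l ih => simp only [listDeriv, schwartzPd_add, ih]

theorem listDeriv_replicate (i : Fin 3) (n : ℕ) (f : 𝓢(Sp, ℝ)) :
    listDeriv (List.replicate n i) f = (schwartzPd i)^[n] f := by
  induction n generalizing f with
  | zero => rfl
  | succ n ih => exact ih _

theorem schwartzMpd_eq_listDeriv (a b c : ℕ) (f : 𝓢(Sp, ℝ)) :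
    schwartzMpd a b c f =
      listDeriv (List.replicate c 2 ++ List.replicate b 1 ++ List.replicate a 0) f := by
  simp only [schwartzMpd, listDeriv_append, listDeriv_replicate]

theorem listDeriv_eq_schwartzMpd (l : List (Fin 3)) (f : 𝓢(Sp, ℝ)) :
    listDeriv l f = schwartzMpd (l.count 0) (l.count 1) (l.count 2) f := by
  induction l generalizing f with
  | nil => rfl
  | cons i l ih =>
    have h (j : Fin 3) (n : ℕ) (g : 𝓢(Sp, ℝ)) :
        (schwartzPd j)^[n] (schwartzPd i g) = schwartzPd i ((schwartzPd j)^[n] g) :=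
      ((schwartzPd_comm j i).iterate_left n) g
    rw [listDeriv, ih]
    simp only [schwartzMpd]
    fin_cases i <;> simp [Function.iterate_succ_apply', h] at h ⊢

theorem length_eq_count_add (l : List (Fin 3)) :
    l.length = l.count 0 + l.count 1 + l.count 2 := by
  induction l with
  | nil => rfl
  | cons i l ih => fin_cases i <;> simp [ih] <;> ring

/-- The derivatives of order between `1` and `m + 1` are controlled by the `H^m` norm of the
gradient. -/
theorem eLpNorm_listDeriv_le (m : ℕ) (l : List (Fin 3)) (hl : l ≠ []) (hm : l.length ≤ m + 1)
    (f : 𝓢(Sp, ℝ)) :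
    eLpNorm (listDeriv l f) 2 volume ≤ (gradSobSq m ⇑f) ^ (1 / 2 : ℝ) := by
  obtain ⟨i, l, rfl⟩ := List.exists_cons_of_ne_nil hl
  have hlen := length_eq_count_add l
  rw [List.length_cons] at hm
  have hsq : nsq (listDeriv (i :: l) f) ≤ gradSobSq m ⇑f := by
    rw [listDeriv, listDeriv_eq_schwartzMpd, coe_schwartzMpd, coe_schwartzPd]
    refine le_trans ?_ (Finset.single_le_sum (f := fun i => sobSq m (pd i ⇑f))
      (fun _ _ => zero_le) (Finset.mem_univ i))
    have hmem (n : ℕ) (hn : n ≤ m) : n ∈ Finset.range (m + 1) := by simp; omega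
    refine le_trans ?_ (Finset.single_le_sum (fun _ _ => zero_le) (hmem (l.count 0) (by omega)))
    refine le_trans ?_ (Finset.single_le_sum (fun _ _ => zero_le) (hmem (l.count 1) (by omega)))
    refine le_trans ?_ (Finset.single_le_sum (fun _ _ => zero_le) (hmem (l.count 2) (by omega)))
    rw [if_pos (by omega)]
  calc eLpNorm (listDeriv (i :: l) f) 2 volume
      = (nsq (listDeriv (i :: l) f)) ^ (1 / 2 : ℝ) := by
        rw [nsq, ← ENNReal.rpow_natCast, ← ENNReal.rpow_mul]; norm_num
    _ ≤ _ := by gcongr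

/-- The pointwise product of two Schwartz functions. -/
def schwartzMul (f g : 𝓢(Sp, ℝ)) : 𝓢(Sp, ℝ) := pairing (ContinuousLinearMap.mul ℝ ℝ) f g

theorem schwartzMul_apply (f g : 𝓢(Sp, ℝ)) (x : Sp) : schwartzMul f g x = f x * g x := rfl

theorem schwartzPd_schwartzMul (i : Fin 3) (f g : 𝓢(Sp, ℝ)) :
    schwartzPd i (schwartzMul f g) =
      schwartzMul (schwartzPd i f) g + schwartzMul f (schwartzPd i g) := by
  ext x
  have h : ⇑(schwartzMul f g) = ⇑f * ⇑g := rfl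
  simp only [coe_schwartzPd, add_apply, schwartzMul_apply, pd, h]
  rw [fderiv_mul f.differentiableAt g.differentiableAt]
  simp
  ring

/-- A Leibniz-type estimate: the derivative of a product is controlled by the products of
derivatives of the same total order. -/
theorem eLpNorm_listDeriv_schwartzMul_le (l : List (Fin 3)) (f g : 𝓢(Sp, ℝ)) (B : ℝ≥0∞)
    (hB : ∀ l₁ l₂ : List (Fin 3), l₁.length + l₂.length = l.length →
      eLpNorm (schwartzMul (listDeriv l₁ f) (listDeriv l₂ g)) 2 volume ≤ B) :
    eLpNorm (listDeriv l (schwartzMul f g)) 2 volume ≤ 2 ^ l.length * B := by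
  induction l generalizing f g with
  | nil => simpa [listDeriv] using hB [] [] rfl
  | cons i l ih =>
    rw [listDeriv, schwartzPd_schwartzMul, listDeriv_add, List.length_cons, pow_succ]
    refine (eLpNorm_add_le (SchwartzMap.continuous _).aestronglyMeasurable
      (SchwartzMap.continuous _).aestronglyMeasurable one_le_two).trans ?_
    have h₁ := ih (schwartzPd i f) g fun l₁ l₂ h => hB (i :: l₁) l₂ (by simp; omega)
    have h₂ := ih f (schwartzPd i g) fun l₁ l₂ h => hB l₁ (i :: l₂) (by simp; omega)
    refine (add_le_add h₁ h₂).trans_eq ?_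
    ring

/-- A real Schwartz function regarded as a complex one. -/
def schwartzOfReal (f : 𝓢(Sp, ℝ)) : 𝓢(Sp, ℂ) := f.postcompCLM Complex.ofRealCLM

theorem schwartzOfReal_apply (f : 𝓢(Sp, ℝ)) (x : Sp) : schwartzOfReal f x = (f x : ℂ) := rfl

theorem schwartzOfReal_schwartzPd (i : Fin 3) (f : 𝓢(Sp, ℝ)) :
    schwartzOfReal (schwartzPd i f) =
      ∂_{EuclideanSpace.single i (1 : ℝ)} (schwartzOfReal f) := by
  ext x
  have h : ⇑(schwartzOfReal f) = Complex.ofRealCLM ∘ ⇑f := rfl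
  rw [schwartzOfReal_apply, lineDerivOp_apply_eq_fderiv, h,
    fderiv_comp x Complex.ofRealCLM.differentiableAt f.differentiableAt]
  simp [coe_schwartzPd, pd]

/-- The Fourier transform of a real Schwartz function. -/
def fourierOfReal (f : 𝓢(Sp, ℝ)) : 𝓢(Sp, ℂ) := 𝓕 (schwartzOfReal f)

theorem norm_fourierOfReal_schwartzPd (i : Fin 3) (f : 𝓢(Sp, ℝ)) (ξ : Sp) :
    ‖fourierOfReal (schwartzPd i f) ξ‖ =
      2 * Real.pi * |ξ i| * ‖fourierOfReal f ξ‖ := by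
  have h : (inner ℝ · (EuclideanSpace.single i (1 : ℝ)) : Sp → ℝ).HasTemperateGrowth := by
    fun_prop
  rw [fourierOfReal, schwartzOfReal_schwartzPd, fourier_lineDerivOp_eq, smul_apply,
    smulLeftCLM_apply_apply h, norm_smul, norm_smul]
  simp [fourierOfReal, abs_of_pos Real.pi_pos, EuclideanSpace.inner_single_right, mul_assoc]

theorem eLpNorm_two_fourierOfReal (f : 𝓢(Sp, ℝ)) :
    eLpNorm (fourierOfReal f) 2 volume = eLpNorm f 2 volume := by
  have h : ‖(fourierOfReal f).toLp 2‖ = ‖(schwartzOfReal f).toLp 2‖ :=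
    norm_fourier_toL2_eq (schwartzOfReal f)
  rw [norm_toLp, norm_toLp,
    ENNReal.toReal_eq_toReal_iff' ((fourierOfReal f).memLp 2 volume).eLpNorm_ne_top
    ((schwartzOfReal f).memLp 2 volume).eLpNorm_ne_top] at h
  rw [h]
  exact eLpNorm_congr_norm_ae (.of_forall fun x => by simp [schwartzOfReal_apply])

theorem enorm_apply_le_eLpNorm_one_fourierOfReal (f : 𝓢(Sp, ℝ)) (x : Sp) :
    ‖f x‖ₑ ≤ eLpNorm (fourierOfReal f) 1 volume := by
  have h := norm_fourier_apply_le_toLp_one (fourierOfReal f) (-x)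
  have hinv : 𝓕 (fourierOfReal f) (-x) = schwartzOfReal f x := by
    have hpair : 𝓕⁻ (fourierOfReal f) = schwartzOfReal f :=
      FourierPair.fourierInv_fourier_eq (schwartzOfReal f)
    rw [← hpair, fourierInv_coe, Real.fourierInv_eq_fourier_neg, fourier_coe]
  rw [hinv, norm_toLp, schwartzOfReal_apply, Complex.norm_real] at h
  rw [← ofReal_norm, ← ENNReal.ofReal_toReal ((fourierOfReal f).memLp 1 volume).eLpNorm_ne_top]
  exact ENNReal.ofReal_le_ofReal h

/-- The weight `1 / (|ξ| (1 + |ξ|))`. -/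
def sobolevWeight (ξ : Sp) : ℝ := (‖ξ‖ * (1 + ‖ξ‖))⁻¹

theorem memLp_two_sobolevWeight : MemLp sobolevWeight 2 volume := by
  have hmeas : Measurable sobolevWeight := by unfold sobolevWeight; fun_prop
  rw [memLp_two_iff_integrable_sq hmeas.aestronglyMeasurable]
  refine (integrable_fun_norm_addHaar volume (f := fun y : ℝ => (y * (1 + y))⁻¹ ^ 2)).2 ?_
  have hint : Integrable (fun y : ℝ => (1 + ‖y‖) ^ (-2 : ℝ)) volume :=
    integrable_one_add_norm (by simp)
  refine (integrableOn_congr_fun (fun y hy => ?_) measurableSet_Ioi).1 hint.integrableOn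
  have hy : 0 < y := hy
  rw [Real.norm_of_nonneg hy.le, Real.rpow_neg (by positivity)]
  simp only [finrank_euclideanSpace, Fintype.card_fin, smul_eq_mul]
  norm_num
  field_simp

theorem norm_mul_one_add_norm_le (ξ : Sp) :
    ‖ξ‖ * (1 + ‖ξ‖) ≤ ∑ i, (|ξ i| + |ξ i| ^ 2) := by
  have hsq : ‖ξ‖ ^ 2 = ∑ i, |ξ i| ^ 2 := by simp [EuclideanSpace.norm_sq_eq]
  have hle : ‖ξ‖ ≤ ∑ i, |ξ i| := by
    refine le_of_sq_le_sq ?_ (Finset.sum_nonneg fun _ _ => abs_nonneg _)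
    rw [hsq]
    exact Finset.sum_sq_le_sq_sum_of_nonneg fun _ _ => abs_nonneg _
  rw [Finset.sum_add_distrib, ← hsq]
  linarith

theorem norm_fourierOfReal_le (f : 𝓢(Sp, ℝ)) {ξ : Sp} (hξ : ξ ≠ 0) :
    ‖fourierOfReal f ξ‖ ≤ ∑ i, sobolevWeight ξ * (‖fourierOfReal (schwartzPd i f) ξ‖ +
      ‖fourierOfReal (schwartzPd i (schwartzPd i f)) ξ‖) := by
  have hξ' : 0 < ‖ξ‖ := norm_pos_iff.2 hξ
  have hπ : 1 ≤ 2 * Real.pi := by linarith [Real.pi_gt_three]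
  rw [← Finset.mul_sum, sobolevWeight, le_inv_mul_iff₀ (by positivity)]
  refine (mul_le_mul_of_nonneg_right (norm_mul_one_add_norm_le ξ) (norm_nonneg _)).trans ?_
  rw [Finset.sum_mul]
  refine Finset.sum_le_sum fun i _ => ?_
  simp only [norm_fourierOfReal_schwartzPd]
  set A := ‖fourierOfReal f ξ‖
  have h₁ : |ξ i| * A ≤ 2 * Real.pi * (|ξ i| * A) := le_mul_of_one_le_left (by positivity) hπ
  have h₂ : |ξ i| ^ 2 * A ≤ (2 * Real.pi) ^ 2 * (|ξ i| ^ 2 * A) :=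
    le_mul_of_one_le_left (by positivity) (one_le_pow₀ hπ)
  linarith

/-- The Sobolev embedding into bounded functions, with homogeneous derivatives of order one and
two only. -/
theorem eLpNorm_top_le_sum_eLpNorm_schwartzPd (f : 𝓢(Sp, ℝ)) :
    eLpNorm f ⊤ volume ≤ eLpNorm sobolevWeight 2 volume *
      ∑ i, (eLpNorm (schwartzPd i f) 2 volume +
        eLpNorm (schwartzPd i (schwartzPd i f)) 2 volume) := by
  have hw := memLp_two_sobolevWeight.aestronglyMeasurable
  have hF (g : 𝓢(Sp, ℝ)) : AEStronglyMeasurable (fun ξ => ‖fourierOfReal g ξ‖) volume :=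
    (SchwartzMap.continuous _).norm.aestronglyMeasurable
  refine (eLpNorm_exponent_top.trans_le (essSup_le_of_ae_le _ (.of_forall
    (enorm_apply_le_eLpNorm_one_fourierOfReal f)))).trans ?_
  have hae : ∀ᵐ ξ : Sp, ‖fourierOfReal f ξ‖ ≤
      (∑ i, sobolevWeight • ((fun ξ => ‖fourierOfReal (schwartzPd i f) ξ‖) +
        fun ξ => ‖fourierOfReal (schwartzPd i (schwartzPd i f)) ξ‖)) ξ := by
    filter_upwards [Measure.ae_ne volume (0 : Sp)] with ξ hξ
    simpa using norm_fourierOfReal_le f hξ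
  refine (eLpNorm_mono_ae_real hae).trans ?_
  refine (eLpNorm_sum_le (fun i _ => hw.smul ((hF _).add (hF _))) le_rfl).trans ?_
  rw [Finset.mul_sum]
  refine Finset.sum_le_sum fun i _ => ?_
  refine (eLpNorm_smul_le_mul_eLpNorm (p := 2) (q := 2) ((hF _).add (hF _)) hw).trans ?_
  gcongr
  refine (eLpNorm_add_le (hF _) (hF _) one_le_two).trans_eq ?_
  rw [eLpNorm_norm, eLpNorm_norm, eLpNorm_two_fourierOfReal,
    eLpNorm_two_fourierOfReal]

theorem eLpNorm_top_listDeriv_le (l : List (Fin 3)) (hl : l.length ≤ 2) (f : 𝓢(Sp, ℝ)) :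
    eLpNorm (listDeriv l f) ⊤ volume ≤
      6 * eLpNorm sobolevWeight 2 volume * (gradSobSq 3 ⇑f) ^ (1 / 2 : ℝ) := by
  have h (l' : List (Fin 3)) (hl' : l' ≠ []) (hlen : l'.length ≤ 2) :
      eLpNorm (listDeriv l' (listDeriv l f)) 2 volume ≤ (gradSobSq 3 ⇑f) ^ (1 / 2 : ℝ) := by
    rw [← listDeriv_append]
    exact eLpNorm_listDeriv_le 3 _ (by simp [hl']) (by simp; omega) f
  calc eLpNorm (listDeriv l f) ⊤ volume
      ≤ eLpNorm sobolevWeight 2 volume * ∑ _i : Fin 3,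
          ((gradSobSq 3 ⇑f) ^ (1 / 2 : ℝ) + (gradSobSq 3 ⇑f) ^ (1 / 2 : ℝ)) := by
        refine (eLpNorm_top_le_sum_eLpNorm_schwartzPd _).trans ?_
        gcongr with i
        · exact h [i] (by simp) (by simp)
        · exact h [i, i] (by simp) (by simp)
    _ = _ := by simp; ring

theorem eLpNorm_schwartzMul_le (f g : 𝓢(Sp, ℝ)) :
    eLpNorm (schwartzMul f g) 2 volume ≤ eLpNorm f ⊤ volume * eLpNorm g 2 volume :=
  eLpNorm_smul_le_mul_eLpNorm (p := ⊤) (q := 2) (r := 2) (φ := ⇑f) (f := ⇑g)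
    (SchwartzMap.continuous _).aestronglyMeasurable
    (SchwartzMap.continuous _).aestronglyMeasurable

theorem schwartzMul_comm (f g : 𝓢(Sp, ℝ)) : schwartzMul f g = schwartzMul g f := by
  ext x
  exact mul_comm _ _

theorem eLpNorm_schwartzMul_listDeriv_le (f g : 𝓢(Sp, ℝ)) (l₁ l₂ : List (Fin 3))
    (h₁ : 1 ≤ l₁.length + l₂.length) (h₄ : l₁.length + l₂.length ≤ 4) :
    eLpNorm (schwartzMul (listDeriv l₁ f) (listDeriv l₂ g)) 2 volume ≤
      6 * eLpNorm sobolevWeight 2 volume * (gradSobSq 3 ⇑f) ^ (1 / 2 : ℝ) *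
        (gradSobSq 3 ⇑g) ^ (1 / 2 : ℝ) := by
  wlog h : l₁.length ≤ l₂.length generalizing f g l₁ l₂
  · rw [schwartzMul_comm, mul_right_comm]
    exact this g f l₂ l₁ (by omega) (by omega) (by omega)
  refine (eLpNorm_schwartzMul_le _ _).trans (mul_le_mul' ?_ ?_)
  · exact eLpNorm_top_listDeriv_le l₁ (by omega) f
  · exact eLpNorm_listDeriv_le 3 l₂ (List.ne_nil_of_length_pos (by omega)) (by omega) g

/-- **Derivative product estimate** (Lemma 2.1, third inequality): for every
multi-index `α = (a,b,c)` with `1 ≤ |α| ≤ 4`,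
`‖∂^α(fg)‖_{L²(ℝ³)} ≤ C ‖∇f‖_{H³} ‖∇g‖_{H³}`. -/
theorem product_derivative_estimate :
    ∃ C : ℝ, 0 < C ∧ ∀ f g : SchwartzMap Sp ℝ, ∀ a b c : ℕ,
      1 ≤ a + b + c → a + b + c ≤ 4 →
      eLpNorm (mpd a b c (fun x => f x * g x)) 2 volume ≤
        ENNReal.ofReal C * (gradSobSq 3 ⇑f) ^ (1/2 : ℝ) * (gradSobSq 3 ⇑g) ^ (1/2 : ℝ) := by
  set K := eLpNorm sobolevWeight 2 volume
  have hK : K ≠ ⊤ := memLp_two_sobolevWeight.eLpNorm_ne_top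
  have hC : 16 * (6 * K) ≤ ENNReal.ofReal (96 * K.toReal + 1) := by
    rw [ENNReal.ofReal_add (by positivity) zero_le_one, ENNReal.ofReal_mul (by norm_num),
      ENNReal.ofReal_toReal hK, ← mul_assoc]
    norm_num
  refine ⟨96 * K.toReal + 1, by positivity, fun f g a b c h₁ h₄ => ?_⟩
  set l : List (Fin 3) := List.replicate c 2 ++ List.replicate b 1 ++ List.replicate a 0 with hl
  have hlen : l.length = a + b + c := by simp [hl]; omega
  have hmpd : mpd a b c (fun x => f x * g x) = listDeriv l (schwartzMul f g) := by
    rw [hl, ← schwartzMpd_eq_listDeriv, coe_schwartzMpd]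
    rfl
  rw [hmpd]
  calc eLpNorm (listDeriv l (schwartzMul f g)) 2 volume
      ≤ 2 ^ l.length * (6 * K * (gradSobSq 3 ⇑f) ^ (1 / 2 : ℝ) *
          (gradSobSq 3 ⇑g) ^ (1 / 2 : ℝ)) :=
        eLpNorm_listDeriv_schwartzMul_le l f g _ fun l₁ l₂ h =>
          eLpNorm_schwartzMul_listDeriv_le f g l₁ l₂ (by omega) (by omega)
    _ ≤ 2 ^ 4 * (6 * K * (gradSobSq 3 ⇑f) ^ (1 / 2 : ℝ) *
          (gradSobSq 3 ⇑g) ^ (1 / 2 : ℝ)) := by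
        gcongr
        · exact one_le_two
        · omega
    _ = 16 * (6 * K) * (gradSobSq 3 ⇑f) ^ (1 / 2 : ℝ) * (gradSobSq 3 ⇑g) ^ (1 / 2 : ℝ) := by
        norm_num [mul_assoc]
    _ ≤ _ := by gcongr
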